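/- arXiv:2210.09775 — 3 statements merged into one kernel-verified Lean document; each statement's English description precedes it below -/
import Mathlib

section
/- There is an absolute constant C > 0 such that for every k ≥ 2 and every set 𝓗 = {h₁, …, h_k} of k distinct integers, 𝔖(𝓗) ≤ C·∏_{p ≤ k³, p prime} (1 − 1/p)^{−k} · ∏_{p > k³, p prime} (1 − k/p)/(1 − 1/p)^k · binom(k,2)^{−1} · ∑_{1 ≤ i < j ≤ k} exp(2·binom(k,2)·∑_{p prime, p > k³, p | (h_i − h_j)} 1/p). -/
open scoped BigOperators

/-- Number of residue classes modulo `p` occupied by the elements of `H`. -/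
noncomputable def nuH (H : Finset ℤ) (p : ℕ) : ℕ :=
  (H.image (fun x => x % (p : ℤ))).card

/-- The singular series of a finite set of integers. -/
noncomputable def singSeries (H : Finset ℤ) : ℝ :=
  ∏' p : Nat.Primes,
    (1 - (nuH H (p : ℕ) : ℝ) / ((p : ℕ) : ℝ)) / (1 - 1 / ((p : ℕ) : ℝ)) ^ H.card

open scoped Classical in
/-- `Tk k h`: sum of singular series over `k`-tuples of distinct integers in `[1, h]`. -/
noncomputable def Tk (k h : ℕ) : ℝ :=
  ∑ f ∈ (Fintype.piFinset (fun _ : Fin k => Finset.Icc (1 : ℤ) (h : ℤ))).filter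
      Function.Injective,
    singSeries (Finset.image f Finset.univ)

theorem one_sub_pow_le_one_sub_add_sq {x : ℝ} (h0 : 0 ≤ x) (h1 : x ≤ 1) (k : ℕ) :
    (1 - x) ^ k ≤ 1 - k * x + k ^ 2 * x ^ 2 := by
  induction k with
  | zero => simp
  | succ k ih =>
    have h := mul_le_mul_of_nonneg_right ih (sub_nonneg.2 h1)
    rw [pow_succ]
    refine h.trans ?_
    push_cast
    have h3 : (0 : ℝ) ≤ k ^ 2 * x ^ 3 := by positivity
    have h4 : (0 : ℝ) ≤ (k + 1) * x ^ 2 := by positivity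
    nlinarith

theorem abs_one_sub_mul_div_one_sub_pow_sub_one_le {x : ℝ} (h0 : 0 ≤ x) (h1 : x ≤ 1 / 2) (k : ℕ) :
    |(1 - k * x) / (1 - x) ^ k - 1| ≤ k ^ 2 * 2 ^ k * x ^ 2 := by
  have hpos : 0 < (1 - x) ^ k := pow_pos (by linarith) k
  have hlow : 1 - k * x ≤ (1 - x) ^ k := by
    have := one_add_mul_le_pow (a := -x) (by linarith) k
    rw [← sub_eq_add_neg] at this
    linarith
  have hup := one_sub_pow_le_one_sub_add_sq h0 (by linarith) k
  have htwo : 1 ≤ 2 ^ k * (1 - x) ^ k := by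
    rw [← mul_pow]
    exact one_le_pow₀ (by linarith)
  rw [div_sub_one hpos.ne', abs_div, abs_of_pos hpos, div_le_iff₀ hpos,
    abs_of_nonpos (by linarith)]
  have h5 : (k : ℝ) ^ 2 * x ^ 2 * 1 ≤ k ^ 2 * x ^ 2 * (2 ^ k * (1 - x) ^ k) := by gcongr
  linarith

theorem Nat.Primes.one_div_le_half (p : Nat.Primes) : 1 / ((p : ℕ) : ℝ) ≤ 1 / 2 := by
  have : (2 : ℝ) ≤ ((p : ℕ) : ℝ) := by exact_mod_cast p.2.two_le
  gcongr

theorem summable_norm_eulerFactor_sub_one (k : ℕ) (ν : Nat.Primes → ℕ)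
    (hν : ∀ᶠ p in Filter.cofinite, ν p = k) :
    Summable fun p : Nat.Primes =>
      ‖(1 - (ν p : ℝ) / ((p : ℕ) : ℝ)) / (1 - 1 / ((p : ℕ) : ℝ)) ^ k - 1‖ := by
  have hs : Summable fun p : Nat.Primes => (k : ℝ) ^ 2 * 2 ^ k * (1 / ((p : ℕ) : ℝ) ^ 2) :=
    ((Real.summable_one_div_nat_pow.2 one_lt_two).comp_injective
      (i := fun p : Nat.Primes => (p : ℕ)) Subtype.val_injective).mul_left _
  refine Summable.of_norm_bounded_eventually hs ?_
  filter_upwards [hν] with p hp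
  rw [norm_norm, hp, Real.norm_eq_abs]
  have := abs_one_sub_mul_div_one_sub_pow_sub_one_le (x := 1 / ((p : ℕ) : ℝ)) (by positivity)
    p.one_div_le_half k
  rwa [mul_one_div, one_div_pow] at this

theorem Nat.Primes.hasProd_of_finset {M : Type*} [CommMonoid M] [TopologicalSpace M]
    {S : Finset ℕ} (hS : ∀ p ∈ S, p.Prime) (g : ℕ → M) :
    HasProd (fun p : Nat.Primes => if (p : ℕ) ∈ S then g p else 1) (∏ p ∈ S, g p) := by
  have h : HasProd (fun n : ℕ => if n ∈ S then g n else 1) (∏ p ∈ S, g p) := by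
    have := hasProd_prod_of_ne_finset_one (f := fun n : ℕ => if n ∈ S then g n else 1) (s := S)
      (L := SummationFilter.unconditional ℕ) (fun b hb => if_neg hb)
    rwa [Finset.prod_congr rfl (fun p hp => if_pos hp)] at this
  have hinj : Function.Injective fun p : Nat.Primes => (p : ℕ) := Subtype.val_injective
  refine (hinj.hasProd_iff (f := fun n : ℕ => if n ∈ S then g n else 1) ?_).2 h
  intro n hn
  have hnS : n ∉ S := fun hmem => hn ⟨⟨n, hS n hmem⟩, rfl⟩
  exact if_neg hnS

theorem Nat.Primes.hasSum_of_finset {M : Type*} [AddCommMonoid M] [TopologicalSpace M]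
    {S : Finset ℕ} (hS : ∀ p ∈ S, p.Prime) (g : ℕ → M) :
    HasSum (fun p : Nat.Primes => if (p : ℕ) ∈ S then g p else 0) (∑ p ∈ S, g p) :=
  Nat.Primes.hasProd_of_finset (M := Multiplicative M) hS g

theorem card_le_card_image_add_card_collisions {β : Type*} [DecidableEq β] {k : ℕ}
    (φ : Fin k → β) :
    k ≤ (Finset.univ.image φ).card +
      ∑ i : Fin k, ∑ j ∈ Finset.univ.filter (fun j => i < j), if φ i = φ j then 1 else 0 := by
  classical
  let A : Finset (Fin k) := Finset.univ.filter fun j => ∀ i < j, φ i ≠ φ j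
  have hA : A.card ≤ (Finset.univ.image φ).card := by
    rw [← Finset.card_image_of_injOn (s := A) (f := φ)]
    · exact Finset.card_le_card (Finset.image_subset_image (Finset.subset_univ _))
    · intro a ha b hb hab
      simp only [A, Finset.coe_filter, Finset.mem_univ, true_and, Set.mem_ofPred_eq] at ha hb
      rcases lt_trichotomy a b with h | h | h
      · exact absurd hab (hb a h)
      · exact h
      · exact absurd hab.symm (ha b h)
  have hB : Aᶜ.card ≤
      ∑ i : Fin k, ∑ j ∈ Finset.univ.filter (fun j => i < j), if φ i = φ j then 1 else 0 := by
    simp_rw [Finset.sum_filter]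
    rw [Finset.sum_comm, Finset.card_eq_sum_ones]
    refine le_trans (Finset.sum_le_sum fun j hj => ?_)
      (Finset.sum_le_sum_of_subset (Finset.subset_univ Aᶜ))
    simp only [A, Finset.mem_compl, Finset.mem_filter, Finset.mem_univ, true_and, not_forall,
      not_not] at hj
    obtain ⟨i, hij, he⟩ := hj
    refine le_trans ?_ (Finset.single_le_sum (fun _ _ => Nat.zero_le _) (Finset.mem_univ i))
    simp [hij, he]
  have := Finset.card_add_card_compl A
  rw [Fintype.card_fin] at this
  omega

theorem sum_card_filter_lt_eq_choose_two (k : ℕ) :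
    ∑ i : Fin k, (Finset.univ.filter (fun j => i < j)).card = k.choose 2 := by
  have h (i : Fin k) : Finset.univ.filter (fun j => i < j) = Finset.Ioi i := by
    ext; simp
  simp_rw [h, Fin.card_Ioi]
  rw [Fin.sum_univ_eq_sum_range (fun i => k - 1 - i), Finset.sum_range_reflect (fun i => i),
    Finset.sum_range_id, Nat.choose_two_right]

theorem exp_sum_pairs_le {k : ℕ} (hk : 2 ≤ k) (S : Fin k → Fin k → ℝ) :
    Real.exp (∑ i : Fin k, ∑ j ∈ Finset.univ.filter (fun j => i < j), S i j) ≤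
      ((k.choose 2 : ℝ))⁻¹ * ∑ i : Fin k, ∑ j ∈ Finset.univ.filter (fun j => i < j),
        Real.exp ((k.choose 2 : ℝ) * S i j) := by
  have hN : (0 : ℝ) < k.choose 2 := by exact_mod_cast Nat.choose_pos hk
  rw [Finset.sum_sigma', Finset.sum_sigma', Finset.mul_sum]
  have := convexOn_exp.map_sum_le
    (t := Finset.univ.sigma fun i : Fin k => Finset.univ.filter (fun j => i < j))
    (w := fun _ => ((k.choose 2 : ℝ))⁻¹) (p := fun x => (k.choose 2 : ℝ) * S x.1 x.2)
    (fun _ _ => by positivity) ?_ (fun _ _ => Set.mem_univ _)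
  · simpa only [smul_eq_mul, inv_mul_cancel_left₀ hN.ne'] using this
  · rw [Finset.sum_const, Finset.card_sigma, sum_card_filter_lt_eq_choose_two, nsmul_eq_mul,
      mul_inv_cancel₀ hN.ne']

theorem nuH_image {k : ℕ} (f : Fin k → ℤ) (p : ℕ) :
    nuH (Finset.image f Finset.univ) p =
      (Finset.univ.image fun i => f i % (p : ℤ)).card := by
  rw [nuH, Finset.image_image]
  rfl

theorem one_le_nuH_image {k : ℕ} (hk : 2 ≤ k) (f : Fin k → ℤ) (p : ℕ) :
    1 ≤ nuH (Finset.image f Finset.univ) p := by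
  rw [nuH_image, Nat.one_le_iff_ne_zero, Finset.card_ne_zero]
  exact ⟨_, Finset.mem_image_of_mem _ (Finset.mem_univ ⟨0, by omega⟩)⟩

theorem nuH_le_self (H : Finset ℤ) {p : ℕ} (hp : 0 < p) : nuH H p ≤ p := by
  have h : H.image (fun x => x % (p : ℤ)) ⊆ Finset.Ico 0 (p : ℤ) := by
    intro y hy
    obtain ⟨x, -, rfl⟩ := Finset.mem_image.1 hy
    have hp' : (0 : ℤ) < p := by exact_mod_cast hp
    exact Finset.mem_Ico.2 ⟨Int.emod_nonneg _ hp'.ne', Int.emod_lt_of_pos _ hp'⟩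
  simpa [nuH] using Finset.card_le_card h

theorem eventually_nuH_image_eq {k : ℕ} {f : Fin k → ℤ} (hf : Function.Injective f) :
    ∀ᶠ p : Nat.Primes in Filter.cofinite, nuH (Finset.image f Finset.univ) p = k := by
  let B : ℕ := ∑ i : Fin k, ∑ j : Fin k, (f i - f j).natAbs
  have hfin : {p : Nat.Primes | (p : ℕ) ≤ B}.Finite :=
    (Set.finite_Iic B).preimage Subtype.val_injective.injOn
  filter_upwards [hfin.compl_mem_cofinite] with p hp
  have hp : B < p := not_le.1 hp
  rw [nuH_image, Finset.card_image_of_injective, Finset.card_univ, Fintype.card_fin]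
  intro i j hij
  have hd : (p : ℕ) ∣ (f i - f j).natAbs :=
    Int.natCast_dvd.1 (Int.ModEq.dvd (Int.ModEq.symm hij))
  have hB : (f i - f j).natAbs ≤ B :=
    (Finset.single_le_sum (f := fun j => (f i - f j).natAbs) (fun _ _ => Nat.zero_le _)
      (Finset.mem_univ j)).trans
      (Finset.single_le_sum (f := fun i => ∑ j : Fin k, (f i - f j).natAbs)
        (fun _ _ => Nat.zero_le _) (Finset.mem_univ i))
  have h0 := Nat.eq_zero_of_dvd_of_lt hd (hB.trans_lt hp)
  exact hf (sub_eq_zero.1 (Int.natAbs_eq_zero.1 h0))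

theorem one_sub_div_le_mul_exp {k ν m p : ℝ} (hp : 0 < p) (hkp : 2 * k ≤ p)
    (hm : 0 ≤ m) (h : k ≤ ν + m) :
    1 - ν / p ≤ (1 - k / p) * Real.exp (2 * m / p) := by
  have h1 : k / p ≤ 1 / 2 := by
    rw [div_le_iff₀ hp]; linarith
  have h2 : 2 * m / p + 1 ≤ Real.exp (2 * m / p) := Real.add_one_le_exp _
  have h3 : k / p ≤ ν / p + m / p := by
    rw [← add_div]; gcongr
  have h4 : 0 ≤ m / p := by positivity
  have h5 : 2 * m / p = 2 * (m / p) := by ring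
  calc 1 - ν / p ≤ (1 - k / p) * (2 * m / p + 1) := by rw [h5]; nlinarith
    _ ≤ _ := by gcongr; linarith

/-- The primes beyond `k ^ 3` dividing the difference `f i - f j`. -/
def largeCommonPrimes {k : ℕ} (f : Fin k → ℤ) (i j : Fin k) : Finset ℕ :=
  (f i - f j).natAbs.primeFactors.filter (fun p => k ^ 3 < p)

theorem emod_eq_iff_mem_largeCommonPrimes {k : ℕ} {f : Fin k → ℤ} (hf : Function.Injective f)
    {p : ℕ} (hp : p.Prime) (hkp : k ^ 3 < p) {i j : Fin k} (hij : i < j) :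
    f i % (p : ℤ) = f j % (p : ℤ) ↔ p ∈ largeCommonPrimes f i j := by
  have hne : f i - f j ≠ 0 := sub_ne_zero.2 (hf.ne hij.ne)
  simp only [largeCommonPrimes, Finset.mem_filter, Nat.mem_primeFactors, hp, hkp, true_and,
    and_true, ne_eq, Int.natAbs_eq_zero, hne, not_false_eq_true]
  rw [← Int.natCast_dvd, eq_comm]
  exact Int.modEq_iff_dvd

theorem one_sub_nuH_div_le {k : ℕ} (hk : 2 ≤ k) {f : Fin k → ℤ} (hf : Function.Injective f)
    {p : ℕ} (hp : p.Prime) (hkp : k ^ 3 < p) :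
    1 - (nuH (Finset.image f Finset.univ) p : ℝ) / p ≤ (1 - (k : ℝ) / p) *
      Real.exp (∑ i : Fin k, ∑ j ∈ Finset.univ.filter (fun j => i < j),
        if p ∈ largeCommonPrimes f i j then 2 * (1 / (p : ℝ)) else 0) := by
  have h2k : 2 * k ≤ p := by
    nlinarith [Nat.mul_le_mul hk hk, Nat.mul_le_mul_left k (Nat.mul_le_mul hk hk)]
  have hp0 : (0 : ℝ) < p := by exact_mod_cast hp.pos
  have hcard := card_le_card_image_add_card_collisions (fun i => f i % (p : ℤ))
  rw [← nuH_image] at hcard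
  have hcard' : (k : ℝ) ≤ nuH (Finset.image f Finset.univ) p +
      ((∑ i : Fin k, ∑ j ∈ Finset.univ.filter (fun j => i < j),
        if f i % (p : ℤ) = f j % (p : ℤ) then 1 else 0 : ℕ) : ℝ) := by exact_mod_cast hcard
  convert one_sub_div_le_mul_exp hp0 (by exact_mod_cast h2k) (Nat.cast_nonneg _) hcard' using 3
  push_cast
  rw [mul_div_right_comm, Finset.mul_sum]
  refine Finset.sum_congr rfl fun i _ => ?_
  rw [Finset.mul_sum]
  refine Finset.sum_congr rfl fun j hj => ?_
  rw [if_congr (emod_eq_iff_mem_largeCommonPrimes hf hp hkp (Finset.mem_filter.1 hj).2) rfl rfl]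
  split_ifs <;> ring

theorem singSeries_le_exp_sum_largeCommonPrimes {k : ℕ} (hk : 2 ≤ k) {f : Fin k → ℤ}
    (hf : Function.Injective f) :
    singSeries (Finset.image f Finset.univ) ≤
      (∏ p ∈ (Finset.range (k ^ 3 + 1)).filter Nat.Prime, ((1 - 1 / (p : ℝ)) ^ k)⁻¹) *
        (∏' p : {p : Nat.Primes // k ^ 3 < (p : ℕ)},
          (1 - (k : ℝ) / ((p.1 : ℕ) : ℝ)) / (1 - 1 / ((p.1 : ℕ) : ℝ)) ^ k) *
        Real.exp (∑ i : Fin k, ∑ j ∈ Finset.univ.filter (fun j => i < j),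
          ∑ p ∈ largeCommonPrimes f i j, 2 * (1 / (p : ℝ))) := by
  classical
  have hcard : (Finset.image f Finset.univ).card = k := by
    rw [Finset.card_image_of_injective _ hf, Finset.card_univ, Fintype.card_fin]
  have hF : Multipliable fun p : Nat.Primes =>
      (1 - (nuH (Finset.image f Finset.univ) p : ℝ) / ((p : ℕ) : ℝ)) /
        (1 - 1 / ((p : ℕ) : ℝ)) ^ k := by
    simpa using multipliable_one_add_of_summable
      (summable_norm_eulerFactor_sub_one k _ (eventually_nuH_image_eq hf))
  let g : Nat.Primes → ℝ := fun p =>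
    (1 - (k : ℝ) / ((p : ℕ) : ℝ)) / (1 - 1 / ((p : ℕ) : ℝ)) ^ k
  have hlarge : Multipliable (g ∘ ((↑) : {p : Nat.Primes | k ^ 3 < (p : ℕ)} → Nat.Primes)) := by
    have h := multipliable_one_add_of_summable
      ((summable_norm_eulerFactor_sub_one k (fun _ => k) (by simp)).subtype
        {p : Nat.Primes | k ^ 3 < (p : ℕ)})
    simp only [add_sub_cancel] at h
    exact h
  have hlarge' := hasProd_subtype_iff_mulIndicator.1 hlarge.hasProd
  have hsmall := Nat.Primes.hasProd_of_finset
    (S := (Finset.range (k ^ 3 + 1)).filter Nat.Prime) (fun p hp => (Finset.mem_filter.1 hp).2)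
    (fun p => ((1 - 1 / (p : ℝ)) ^ k)⁻¹)
  have hexp := (hasSum_sum (s := Finset.univ) fun (i : Fin k) _ =>
    hasSum_sum (s := Finset.univ.filter (fun j => i < j)) fun j _ =>
      Nat.Primes.hasSum_of_finset (S := largeCommonPrimes f i j)
        (fun p hp => Nat.prime_of_mem_primeFactors (Finset.mem_filter.1 hp).1)
        (fun p => 2 * (1 / (p : ℝ)))).rexp
  rw [singSeries, hcard]
  refine le_of_tendsto_of_tendsto' hF.hasProd ((hsmall.mul hlarge').mul hexp) fun s =>
    Finset.prod_le_prod (fun p _ => ?_) fun p _ => ?_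
  · have h1 : (nuH (Finset.image f Finset.univ) p : ℝ) / ((p : ℕ) : ℝ) ≤ 1 :=
      div_le_one_of_le₀ (by exact_mod_cast nuH_le_self _ p.2.pos) (Nat.cast_nonneg _)
    exact div_nonneg (by linarith) (pow_nonneg (by linarith [p.one_div_le_half]) k)
  · have hden : 0 < (1 - 1 / ((p : ℕ) : ℝ)) ^ k := pow_pos (by linarith [p.one_div_le_half]) k
    by_cases hkp : k ^ 3 < (p : ℕ)
    · have hns : (p : ℕ) ∉ (Finset.range (k ^ 3 + 1)).filter Nat.Prime := by
        simp only [Finset.mem_filter, Finset.mem_range]; omega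
      have hmem : p ∈ {p : Nat.Primes | k ^ 3 < (p : ℕ)} := hkp
      rw [if_neg hns, one_mul, Set.mulIndicator_of_mem hmem, div_mul_eq_mul_div]
      exact div_le_div_of_nonneg_right (one_sub_nuH_div_le hk hf p.2 hkp) hden.le
    · have hs : (p : ℕ) ∈ (Finset.range (k ^ 3 + 1)).filter Nat.Prime := by
        simp only [Finset.mem_filter, Finset.mem_range]; exact ⟨by omega, p.2⟩
      have hmem : p ∉ {p : Nat.Primes | k ^ 3 < (p : ℕ)} := hkp
      rw [if_pos hs, Set.mulIndicator_of_notMem hmem, mul_one, div_eq_mul_inv, mul_comm]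
      refine mul_le_mul_of_nonneg_left ?_ (inv_nonneg.2 hden.le)
      refine le_trans (sub_le_self _ (by positivity)) (Real.one_le_exp ?_)
      exact Finset.sum_nonneg fun i _ => Finset.sum_nonneg fun j _ => by positivity

/-- There is an absolute `C > 0` such that for every `k ≥ 2` and every set
`𝓗 = {h₁, …, h_k}` of `k` distinct integers,
`𝔖(𝓗) ≤ C ∏_{p ≤ k³}(1-1/p)^{-k} ∏_{p > k³}((1-k/p)/(1-1/p)^k) ⬝ binom(k,2)⁻¹
  ∑_{i<j} exp(2 binom(k,2) ∑_{p > k³, p ∣ hᵢ-hⱼ} 1/p)`. -/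
theorem singSeries_amgm_bound :
    ∃ C > (0 : ℝ), ∀ k : ℕ, 2 ≤ k → ∀ f : Fin k → ℤ, Function.Injective f →
      singSeries (Finset.image f Finset.univ) ≤
        C * (∏ p ∈ (Finset.range (k ^ 3 + 1)).filter Nat.Prime,
              ((1 - 1 / (p : ℝ)) ^ k)⁻¹) *
          (∏' p : {p : Nat.Primes // k ^ 3 < (p : ℕ)},
              (1 - (k : ℝ) / ((p.1 : ℕ) : ℝ)) / (1 - 1 / ((p.1 : ℕ) : ℝ)) ^ k) *
          ((k.choose 2 : ℝ))⁻¹ *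
          ∑ i : Fin k, ∑ j ∈ Finset.univ.filter (fun j => i < j),
            Real.exp (2 * (k.choose 2 : ℝ) *
              ∑ p ∈ (f i - f j).natAbs.primeFactors.filter (fun p => k ^ 3 < p),
                (1 : ℝ) / p) := by
  refine ⟨1, one_pos, fun k hk f hf => ?_⟩
  refine (singSeries_le_exp_sum_largeCommonPrimes hk hf).trans ?_
  rw [one_mul, mul_assoc _ ((k.choose 2 : ℝ))⁻¹]
  refine mul_le_mul_of_nonneg_left ?_ ?_
  · refine (exp_sum_pairs_le hk _).trans_eq ?_
    simp_rw [← Finset.mul_sum, ← mul_assoc, mul_comm (k.choose 2 : ℝ) 2]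
    rfl
  · refine mul_nonneg (Finset.prod_nonneg fun p hp => ?_) ?_
    · have := Nat.Primes.one_div_le_half ⟨p, (Finset.mem_filter.1 hp).2⟩
      exact inv_nonneg.2 (pow_nonneg (by simp only at this; linarith) k)
    · refine tprod_nonneg fun p => ?_
      have hpk : (k : ℝ) / ((p.1 : ℕ) : ℝ) ≤ 1 :=
        div_le_one_of_le₀
          (by exact_mod_cast (Nat.le_self_pow three_ne_zero k).trans p.2.le) (Nat.cast_nonneg _)
      exact div_nonneg (by linarith) (pow_nonneg (by linarith [p.1.one_div_le_half]) k)
end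

section
/- There is an absolute constant C > 0 such that for all integers k ≥ 2 and h ≥ 1, S_k(h) ≤ C·h^k, where S_k(h) := ∑ over sets 𝓗 = {h₁, …, h_k} of k distinct integers in [1,h] of binom(k,2)^{−1}·∑_{1 ≤ i < j ≤ k} exp(2·binom(k,2)·∑_{p prime, p > k³, p | (h_i − h_j)} 1/p). -/
open scoped BigOperators

open scoped Classical in
/-- `Sk k h`: sum over sets `𝓗` of `k` distinct integers in `[1,h]` of
`binom(k,2)⁻¹ ∑_{i<j} exp(2 binom(k,2) ∑_{p > k³, p ∣ hᵢ - hⱼ} 1/p)`. -/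
noncomputable def Sk (k h : ℕ) : ℝ :=
  ∑ H ∈ (Finset.Icc (1 : ℤ) (h : ℤ)).powersetCard k,
    ((k.choose 2 : ℝ))⁻¹ *
      ∑ a ∈ H, ∑ b ∈ H.filter (fun b => a < b),
        Real.exp (2 * (k.choose 2 : ℝ) *
          ∑ p ∈ (a - b).natAbs.primeFactors.filter (fun p => k ^ 3 < p), (1 : ℝ) / p)

/-- Expand a product of `1 + g p` over the prime factors of `d` exceeding `N` and average over
`d ≤ h`: only multiples of squarefree integers matter, giving an Euler product bound. -/
lemma sum_prod_one_add_le (g : ℕ → ℝ) (hg : ∀ p, 0 ≤ g p) (N h : ℕ) :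
    ∑ d ∈ Finset.Icc 1 h, ∏ p ∈ d.primeFactors.filter (fun p => N < p), (1 + g p) ≤
      h * ∏ p ∈ (Finset.Ioc N h).filter Nat.Prime, (1 + g p / p) := by
  set P := (Finset.Ioc N h).filter Nat.Prime with hP
  have hexp : ∀ d ∈ Finset.Icc 1 h,
      ∏ p ∈ d.primeFactors.filter (fun p => N < p), (1 + g p) ≤
        ∑ S ∈ P.powerset, if (∏ p ∈ S, p) ∣ d then ∏ p ∈ S, g p else 0 := by
    intro d hd
    rw [Finset.mem_Icc] at hd
    rw [Finset.prod_one_add, ← Finset.sum_filter]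
    refine Finset.sum_le_sum_of_subset_of_nonneg ?_
      (fun S _ _ => Finset.prod_nonneg fun p _ => hg p)
    intro S hS
    rw [Finset.mem_powerset] at hS
    rw [Finset.mem_filter, Finset.mem_powerset]
    have hS' : ∀ p ∈ S, p.Prime ∧ p ∣ d ∧ N < p := by
      intro p hp
      have := hS hp
      rw [Finset.mem_filter, Nat.mem_primeFactors] at this
      exact ⟨this.1.1, this.1.2.1, this.2⟩
    refine ⟨fun p hp => ?_, ?_⟩
    · obtain ⟨h1, h2, h3⟩ := hS' p hp
      rw [hP, Finset.mem_filter, Finset.mem_Ioc]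
      exact ⟨⟨h3, (Nat.le_of_dvd hd.1 h2).trans hd.2⟩, h1⟩
    · exact Finset.prod_primes_dvd d (fun p hp => (hS' p hp).1.prime) (fun p hp => (hS' p hp).2.1)
  refine (Finset.sum_le_sum hexp).trans ?_
  rw [Finset.sum_comm, Finset.prod_one_add, Finset.mul_sum]
  refine Finset.sum_le_sum fun S _ => ?_
  rw [← Finset.sum_filter, Finset.sum_const, nsmul_eq_mul, Finset.prod_div_distrib]
  have hcard : ((Finset.Icc 1 h).filter (fun d => (∏ p ∈ S, p) ∣ d)).card = h / ∏ p ∈ S, p :=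
    Nat.Ioc_filter_dvd_card_eq_div h _
  rw [hcard, ← mul_div_assoc, mul_comm (h : ℝ), mul_div_assoc, mul_comm]
  refine mul_le_mul_of_nonneg_left ?_ (Finset.prod_nonneg fun p _ => hg p)
  have := @Nat.cast_div_le ℝ _ _ _ h (∏ p ∈ S, p)
  simpa using this

lemma sum_primes_inv_sq_le {N : ℕ} (hN : N ≠ 0) (h : ℕ) :
    ∑ p ∈ (Finset.Ioc N h).filter Nat.Prime, ((p : ℝ) ^ 2)⁻¹ ≤ (N : ℝ)⁻¹ := by
  calc ∑ p ∈ (Finset.Ioc N h).filter Nat.Prime, ((p : ℝ) ^ 2)⁻¹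
      ≤ ∑ p ∈ Finset.Ioc N (max N h), ((p : ℝ) ^ 2)⁻¹ := by
        refine Finset.sum_le_sum_of_subset_of_nonneg ?_ (fun _ _ _ => by positivity)
        exact (Finset.filter_subset _ _).trans
          (Finset.Ioc_subset_Ioc_right (le_max_right _ _))
    _ ≤ (N : ℝ)⁻¹ - ((max N h : ℕ) : ℝ)⁻¹ := sum_Ioc_inv_sq_le_sub hN (le_max_left _ _)
    _ ≤ (N : ℝ)⁻¹ := sub_le_self _ (by positivity)

/-- The exponential of `t ∑ 1 / p` over the primes `p > N` dividing `d` is bounded on average. -/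
lemma sum_exp_primeFactors_le {t : ℝ} {N : ℕ} (ht : 0 ≤ t) (hN : N ≠ 0) (htN : t ≤ N) (h : ℕ) :
    ∑ d ∈ Finset.Icc 1 h,
      Real.exp (t * ∑ p ∈ d.primeFactors.filter (fun p => N < p), (1 : ℝ) / p) ≤
      h * Real.exp (2 * t / N) := by
  have hprod : ∀ d : ℕ,
      Real.exp (t * ∑ p ∈ d.primeFactors.filter (fun p => N < p), (1 : ℝ) / p) =
        ∏ p ∈ d.primeFactors.filter (fun p => N < p), (1 + (Real.exp (t / p) - 1)) := by
    intro d
    rw [Finset.mul_sum, Real.exp_sum]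
    exact Finset.prod_congr rfl fun p _ => by rw [mul_one_div]; ring
  have hg : ∀ p : ℕ, 0 ≤ Real.exp (t / p) - 1 := fun p => by
    have : 0 ≤ t / p := by positivity
    linarith [Real.one_le_exp this]
  simp_rw [hprod]
  refine (sum_prod_one_add_le _ hg N h).trans ?_
  refine mul_le_mul_of_nonneg_left ?_ (Nat.cast_nonneg h)
  calc ∏ p ∈ (Finset.Ioc N h).filter Nat.Prime, (1 + (Real.exp (t / p) - 1) / p)
      ≤ ∏ p ∈ (Finset.Ioc N h).filter Nat.Prime, Real.exp (2 * t * ((p : ℝ) ^ 2)⁻¹) := by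
        refine Finset.prod_le_prod (fun p _ => ?_) (fun p hp => ?_)
        · have := div_nonneg (hg p) (Nat.cast_nonneg p)
          linarith
        · rw [Finset.mem_filter, Finset.mem_Ioc] at hp
          have hp0 : (0 : ℝ) < p := by exact_mod_cast hp.2.pos
          have hNp : (N : ℝ) ≤ p := by exact_mod_cast hp.1.1.le
          have hx0 : 0 ≤ t / p := by positivity
          have hx1 : t / p ≤ 1 := (div_le_one hp0).2 (htN.trans hNp)
          have hb := Real.abs_exp_sub_one_le (x := t / p) (by rwa [abs_of_nonneg hx0])
          rw [abs_of_nonneg (hg p), abs_of_nonneg hx0] at hb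
          have h1 : (Real.exp (t / p) - 1) / p ≤ 2 * t * ((p : ℝ) ^ 2)⁻¹ := by
            calc (Real.exp (t / p) - 1) / p ≤ 2 * (t / p) / p := by gcongr
              _ = 2 * t * ((p : ℝ) ^ 2)⁻¹ := by field_simp
          linarith [Real.add_one_le_exp (2 * t * ((p : ℝ) ^ 2)⁻¹)]
    _ = Real.exp (2 * t * ∑ p ∈ (Finset.Ioc N h).filter Nat.Prime, ((p : ℝ) ^ 2)⁻¹) := by
        rw [← Real.exp_sum, Finset.mul_sum]
    _ ≤ Real.exp (2 * t / N) := by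
        rw [Real.exp_le_exp, div_eq_mul_inv]
        exact mul_le_mul_of_nonneg_left (sum_primes_inv_sq_le hN h) (by positivity)

lemma card_powersetCard_filter_pair_le {α : Type*} [DecidableEq α] (s : Finset α) (k : ℕ)
    {a b : α} (hab : a ≠ b) :
    ((s.powersetCard k).filter (fun H => a ∈ H ∧ b ∈ H)).card ≤ s.card ^ (k - 2) := by
  calc ((s.powersetCard k).filter (fun H => a ∈ H ∧ b ∈ H)).card
      ≤ (s.powersetCard (k - 2)).card := by
        refine Finset.card_le_card_of_injOn (fun H => (H.erase a).erase b) ?_ ?_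
        · intro H hH
          simp only [Finset.coe_filter, Finset.mem_powersetCard, Set.mem_ofPred_eq] at hH
          obtain ⟨⟨hHs, hHk⟩, ha, hb⟩ := hH
          simp only [Finset.mem_coe, Finset.mem_powersetCard]
          refine ⟨((Finset.erase_subset _ _).trans (Finset.erase_subset _ _)).trans hHs, ?_⟩
          rw [Finset.card_erase_of_mem (Finset.mem_erase.2 ⟨hab.symm, hb⟩),
            Finset.card_erase_of_mem ha, hHk]
          rfl
        · intro H hH H' hH' heq
          simp only [Finset.coe_filter, Set.mem_ofPred_eq] at hH hH'
          have h1 : H.erase a = H'.erase a := by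
            rw [← Finset.insert_erase (Finset.mem_erase.2 ⟨hab.symm, hH.2.2⟩),
              ← Finset.insert_erase (Finset.mem_erase.2 ⟨hab.symm, hH'.2.2⟩)]
            exact congrArg _ heq
          rw [← Finset.insert_erase hH.2.1, ← Finset.insert_erase hH'.2.1, h1]
    _ ≤ s.card ^ (k - 2) := by
        rw [Finset.card_powersetCard]
        exact Nat.choose_le_pow _ _

lemma sum_powersetCard_pairs_le {α : Type*} [LinearOrder α] (s : Finset α) (k : ℕ)
    (f : α → α → ℝ) (hf : ∀ a b, 0 ≤ f a b) :
    ∑ H ∈ s.powersetCard k, ∑ a ∈ H, ∑ b ∈ H.filter (fun b => a < b), f a b ≤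
      (s.card : ℝ) ^ (k - 2) * ∑ a ∈ s, ∑ b ∈ s.filter (fun b => a < b), f a b := by
  have hH : ∀ H ∈ s.powersetCard k,
      ∑ a ∈ H, ∑ b ∈ H.filter (fun b => a < b), f a b =
        ∑ a ∈ s, ∑ b ∈ s.filter (fun b => a < b), if a ∈ H ∧ b ∈ H then f a b else 0 := by
    intro H hH
    have hHs := (Finset.mem_powersetCard.1 hH).1
    have hout : ∑ a ∈ H, ∑ b ∈ s.filter (fun b => a < b), (if a ∈ H ∧ b ∈ H then f a b else 0) =
        ∑ a ∈ s, ∑ b ∈ s.filter (fun b => a < b), if a ∈ H ∧ b ∈ H then f a b else 0 :=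
      Finset.sum_subset hHs fun a _ ha => Finset.sum_eq_zero fun b _ => if_neg fun h => ha h.1
    rw [← hout]
    refine Finset.sum_congr rfl fun a ha => ?_
    rw [← Finset.sum_filter]
    refine Finset.sum_congr ?_ fun _ _ => rfl
    ext b
    simp only [Finset.mem_filter]
    exact ⟨fun h => ⟨⟨hHs h.1, h.2⟩, ha, h.1⟩, fun h => ⟨h.2.2, h.1.2⟩⟩
  rw [Finset.sum_congr rfl hH, Finset.sum_comm, Finset.mul_sum]
  refine Finset.sum_le_sum fun a _ => ?_
  rw [Finset.sum_comm, Finset.mul_sum]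
  refine Finset.sum_le_sum fun b hb => ?_
  rw [← Finset.sum_filter, Finset.sum_const, nsmul_eq_mul]
  refine mul_le_mul_of_nonneg_right ?_ (hf a b)
  exact_mod_cast card_powersetCard_filter_pair_le s k (Finset.mem_filter.1 hb).2.ne

lemma sum_pairs_natAbs_sub_le (F : ℕ → ℝ) (hF : ∀ d, 0 ≤ F d) (h : ℕ) :
    ∑ a ∈ Finset.Icc (1 : ℤ) h, ∑ b ∈ (Finset.Icc (1 : ℤ) h).filter (fun b => a < b),
      F (a - b).natAbs ≤ h * ∑ d ∈ Finset.Icc 1 h, F d := by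
  have hrow : ∀ a ∈ Finset.Icc (1 : ℤ) h,
      ∑ b ∈ (Finset.Icc (1 : ℤ) h).filter (fun b => a < b), F (a - b).natAbs ≤
        ∑ d ∈ Finset.Icc 1 h, F d := by
    intro a ha
    rw [Finset.mem_Icc] at ha
    rw [← Finset.sum_image (f := F) (g := fun b : ℤ => (a - b).natAbs)]
    · refine Finset.sum_le_sum_of_subset_of_nonneg ?_ (fun d _ _ => hF d)
      intro d hd
      simp only [Finset.mem_image, Finset.mem_filter, Finset.mem_Icc] at hd ⊢
      omega
    · intro b hb c hc hbc
      simp only [Finset.coe_filter, Finset.mem_Icc, Set.mem_ofPred_eq] at hb hc hbc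
      omega
  refine (Finset.sum_le_sum hrow).trans ?_
  simp

/-- There is an absolute constant `C > 0` such that for all `k ≥ 2` and `h ≥ 1`,
`S_k(h) ≤ C h^k`. -/
theorem Sk_bound : ∃ C > (0 : ℝ), ∀ k h : ℕ, 2 ≤ k → 1 ≤ h →
    Sk k h ≤ C * (h : ℝ) ^ k := by
  refine ⟨Real.exp 1, Real.exp_pos 1, fun k h hk _ => ?_⟩
  have hk2 : (2 : ℝ) ≤ k := by exact_mod_cast hk
  have hK1 : (1 : ℝ) ≤ k.choose 2 := by exact_mod_cast Nat.choose_pos hk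
  have hK : 2 * (k.choose 2 : ℝ) ≤ (k : ℝ) ^ 2 := by
    rw [Nat.cast_choose_two]
    nlinarith
  have hk3 : 2 * (k : ℝ) ^ 2 ≤ ((k ^ 3 : ℕ) : ℝ) := by
    push_cast
    nlinarith [sq_nonneg (k : ℝ)]
  set F : ℕ → ℝ := fun d => Real.exp (2 * (k.choose 2 : ℝ) *
    ∑ p ∈ d.primeFactors.filter (fun p => k ^ 3 < p), (1 : ℝ) / p) with hFdef
  have hF : ∀ d, 0 ≤ F d := fun d => (Real.exp_pos _).le
  have hsum : ∑ d ∈ Finset.Icc 1 h, F d ≤ h * Real.exp 1 := by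
    refine (sum_exp_primeFactors_le (by positivity) (pow_ne_zero 3 (by omega))
      (by nlinarith) h).trans ?_
    gcongr
    rw [div_le_one (by positivity)]
    linarith
  have hpairs := sum_powersetCard_pairs_le (Finset.Icc (1 : ℤ) h) k
    (fun a b => F (a - b).natAbs) (fun a b => hF _)
  have hcard : (Finset.Icc (1 : ℤ) h).card = h := by simp
  rw [hcard] at hpairs
  have hSk : Sk k h = ((k.choose 2 : ℝ))⁻¹ *
      ∑ H ∈ (Finset.Icc (1 : ℤ) (h : ℤ)).powersetCard k,
        ∑ a ∈ H, ∑ b ∈ H.filter (fun b => a < b), F (a - b).natAbs := by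
    rw [Sk, Finset.mul_sum]
  rw [hSk]
  calc _ ≤ ∑ H ∈ (Finset.Icc (1 : ℤ) (h : ℤ)).powersetCard k,
        ∑ a ∈ H, ∑ b ∈ H.filter (fun b => a < b), F (a - b).natAbs :=
        mul_le_of_le_one_left (Finset.sum_nonneg fun _ _ => Finset.sum_nonneg fun _ _ =>
          Finset.sum_nonneg fun _ _ => hF _) (inv_le_one_of_one_le₀ hK1)
    _ ≤ (h : ℝ) ^ (k - 2) * (h * (h * Real.exp 1)) := by
        refine hpairs.trans (mul_le_mul_of_nonneg_left ?_ (by positivity))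
        exact (sum_pairs_natAbs_sub_le F hF h).trans
          (mul_le_mul_of_nonneg_left hsum (Nat.cast_nonneg h))
    _ = Real.exp 1 * (h : ℝ) ^ k := by
        obtain ⟨m, rfl⟩ := Nat.exists_eq_add_of_le hk
        rw [Nat.add_sub_cancel_left]
        ring
end

section
/- Let 𝓗 = {h₁, …, h_k} be an admissible set of k ≥ 2 distinct natural numbers (admissible meaning ν_𝓗(p) < p for every prime p), and let D_𝓗 := ∏_{1 ≤ i < j ≤ k} (h_i − h_j). Then: (i) for every prime p, ν_𝓗(p)/p ≤ 1 − 1/(k+1); and (ii) there is an absolute constant C > 0 such that for all real 2 ≤ w ≤ z, one has ∑_{w ≤ p < z, p prime} ν_𝓗(p)·log p / p ≤ k·log(z/w) + C·k, and ∑_{w ≤ p < z, p prime} ν_𝓗(p)·log p / p ≥ k·log(z/w) − C·k − C·k·log log(3|D_𝓗|). -/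
open scoped BigOperators

/-- A set is admissible if it does not cover all residue classes modulo any prime. -/
def Admissible (H : Finset ℤ) : Prop := ∀ p : ℕ, p.Prime → nuH H p < p

open Finset in
/-- The sum of `log p / (p (p - 1))` over any finite set of integers `p ≥ 2` is bounded. -/
theorem exists_sum_log_div_mul_pred_le :
    ∃ A : ℝ, ∀ s : Finset ℕ, (∀ p ∈ s, 2 ≤ p) →
      ∑ p ∈ s, Real.log p / (p * (p - 1)) ≤ A := by
  have hs : Summable (fun n : ℕ => 4 * (1 / (n : ℝ) ^ (3 / 2 : ℝ))) :=
    (Real.summable_one_div_nat_rpow.2 (by norm_num)).mul_left 4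
  refine ⟨_, fun s hp => le_trans (sum_le_sum fun p hps => ?_)
    (hs.sum_le_tsum s fun n _ => by positivity)⟩
  have h2 : (2 : ℝ) ≤ p := by exact_mod_cast hp p hps
  have hlog := Real.log_natCast_le_rpow_div p (ε := 1 / 2) (by norm_num)
  have hpow : (p : ℝ) ^ (1 / 2 : ℝ) * (p : ℝ) ^ (3 / 2 : ℝ) = p ^ 2 := by
    rw [← Real.rpow_add (by linarith)]
    norm_num
  have hpos : 0 < (p : ℝ) ^ (3 / 2 : ℝ) := by positivity
  rw [mul_one_div, div_le_div_iff₀ (by nlinarith) hpos]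
  calc Real.log p * (p : ℝ) ^ (3 / 2 : ℝ)
      ≤ (p : ℝ) ^ (1 / 2 : ℝ) / (1 / 2) * (p : ℝ) ^ (3 / 2 : ℝ) := by gcongr
    _ = 2 * (p : ℝ) ^ 2 := by rw [← hpow]; ring
    _ ≤ 4 * (p * (p - 1)) := by nlinarith

theorem Nat.log_factorial_eq_sum_primesLE (n : ℕ) :
    Real.log (n.factorial : ℝ) =
      ∑ p ∈ n.primesLE, (n.factorial.factorization p : ℝ) * Real.log p := by
  rw [Real.log_nat_eq_sum_factorization]
  refine Finsupp.sum_of_support_subset _ (fun p hp => ?_) _ (by simp)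
  rw [Nat.support_factorization, Nat.mem_primeFactors] at hp
  exact Nat.mem_primesLE.2 ⟨(hp.1.dvd_factorial).1 hp.2.1, hp.1⟩

/-- **Mertens' first theorem.** -/
theorem exists_abs_sum_primesLE_log_div_sub_log_le :
    ∃ A : ℝ, ∀ n : ℕ, 1 ≤ n →
      |∑ p ∈ n.primesLE, Real.log p / p - Real.log n| ≤ A := by
  obtain ⟨B, hB⟩ := exists_sum_log_div_mul_pred_le
  refine ⟨max (Real.log 4) (B + 1), fun n hn => ?_⟩
  have hn0 : (0 : ℝ) < n := by exact_mod_cast hn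
  rw [abs_le']
  constructor
  · refine le_trans ?_ (le_max_left _ _)
    have hupper : Real.log (n.factorial : ℝ) ≤ n * Real.log n := by
      rw [← Real.log_pow]
      exact Real.log_le_log (by positivity) (by exact_mod_cast n.factorial_le_pow)
    have hterm : ∀ p ∈ n.primesLE, n * (Real.log p / p) - Real.log p ≤
        (n.factorial.factorization p : ℝ) * Real.log p := by
      intro p hp
      obtain ⟨hpn, hpp⟩ := Nat.mem_primesLE.1 hp
      have hdiv : n / p ≤ n.factorial.factorization p := by
        rw [Nat.factorization_factorial hpp (Nat.lt_add_one (Nat.log p n))]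
        have h1 : 1 ∈ Finset.Ico 1 (Nat.log p n + 1) := by
          have := Nat.log_pos hpp.one_lt hpn
          simp only [Finset.mem_Ico]
          lia
        simpa using Finset.single_le_sum (f := fun i => n / p ^ i) (fun _ _ => Nat.zero_le _) h1
      have hfloor : (n : ℝ) / p - 1 ≤ (n.factorial.factorization p : ℝ) := by
        have h1 : (n : ℝ) / p < ((n / p : ℕ) : ℝ) + 1 := by
          rw [← Nat.floor_div_eq_div (K := ℝ)]
          exact Nat.lt_floor_add_one _
        have h2 : ((n / p : ℕ) : ℝ) ≤ (n.factorial.factorization p : ℝ) := by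
          exact_mod_cast hdiv
        linarith
      have := mul_le_mul_of_nonneg_right hfloor (Real.log_natCast_nonneg p)
      calc n * (Real.log p / p) - Real.log p = (n / p - 1) * Real.log p := by ring
        _ ≤ _ := this
    have hsum := Finset.sum_le_sum hterm
    rw [← Nat.log_factorial_eq_sum_primesLE, Finset.sum_sub_distrib, ← Finset.mul_sum,
      ← Chebyshev.theta_eq_sum_primesLE_log] at hsum
    have htheta := Chebyshev.theta_le_log4_mul_x hn0.le
    refine le_of_mul_le_mul_left ?_ hn0
    linarith
  · refine le_trans ?_ (le_max_right _ _)
    have hlower := Stirling.le_log_factorial_stirling (n := n) (by lia)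
    have hterm : ∀ p ∈ n.primesLE, (n.factorial.factorization p : ℝ) * Real.log p ≤
        n * (Real.log p / p) + n * (Real.log p / (p * (p - 1))) := by
      intro p hp
      obtain ⟨hpn, hpp⟩ := Nat.mem_primesLE.1 hp
      have h2 : (2 : ℝ) ≤ p := by exact_mod_cast hpp.two_le
      have hle : (n.factorial.factorization p : ℝ) ≤ n / (p - 1) := by
        have h1 : (n.factorial.factorization p : ℝ) ≤ ((n / (p - 1) : ℕ) : ℝ) := by
          exact_mod_cast Nat.factorization_factorial_le_div_pred hpp n
        refine h1.trans (Nat.cast_div_le.trans_eq ?_)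
        rw [Nat.cast_sub hpp.one_le, Nat.cast_one]
      have hne : (p : ℝ) - 1 ≠ 0 := by linarith
      calc _ ≤ n / (p - 1) * Real.log p :=
            mul_le_mul_of_nonneg_right hle (Real.log_natCast_nonneg p)
        _ = _ := by field_simp; ring
    have hsum := Finset.sum_le_sum hterm
    rw [← Nat.log_factorial_eq_sum_primesLE, Finset.sum_add_distrib, ← Finset.mul_sum,
      ← Finset.mul_sum] at hsum
    have hBn := mul_le_mul_of_nonneg_left
      (hB n.primesLE fun p hp => (Nat.mem_primesLE.1 hp).2.two_le) hn0.le
    have hlog1 : 0 ≤ Real.log n := Real.log_natCast_nonneg n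
    have hlog2 : 0 ≤ Real.log (2 * Real.pi) :=
      Real.log_nonneg (by linarith [Real.pi_gt_three])
    refine le_of_mul_le_mul_left ?_ hn0
    linarith

theorem exists_abs_sum_primesBelow_ceil_log_div_sub_log_le :
    ∃ A : ℝ, ∀ x : ℝ, 2 ≤ x →
      |∑ p ∈ ⌈x⌉₊.primesBelow, Real.log p / p - Real.log x| ≤ A := by
  obtain ⟨A, hA⟩ := exists_abs_sum_primesLE_log_div_sub_log_le
  refine ⟨A + Real.log 2, fun x hx => ?_⟩
  obtain ⟨n, hn⟩ : ∃ n, ⌈x⌉₊ = n + 1 :=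
    Nat.exists_eq_succ_of_ne_zero (Nat.ceil_pos.2 (by linarith)).ne'
  have hle : x ≤ n + 1 := by
    have := Nat.le_ceil x
    rw [hn] at this
    exact_mod_cast this
  have hlt : (n : ℝ) < x := Nat.lt_ceil.1 (by lia)
  have hn1 : (1 : ℝ) ≤ n := by linarith
  have h := hA n (by exact_mod_cast hn1)
  have hlog1 : Real.log n ≤ Real.log x := Real.log_le_log (by linarith) hlt.le
  have hlog2 : Real.log x ≤ Real.log 2 + Real.log n := by
    rw [← Real.log_mul (by norm_num) (by linarith)]
    exact Real.log_le_log (by linarith) (by linarith)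
  have hlog0 : 0 ≤ Real.log 2 := Real.log_nonneg (by norm_num)
  rw [hn]
  rw [Nat.primesLE, abs_le] at h
  rw [abs_le]
  constructor <;> linarith

theorem exists_sum_primeFactors_log_div_le :
    ∃ A : ℝ, ∀ m : ℕ, m ≠ 0 →
      ∑ p ∈ m.primeFactors, Real.log p / p ≤ Real.log (Real.log (3 * m)) + A := by
  obtain ⟨A, hA⟩ := exists_abs_sum_primesLE_log_div_sub_log_le
  refine ⟨A + 1, fun m hm => ?_⟩
  have hm1 : (1 : ℝ) ≤ m := by exact_mod_cast Nat.one_le_iff_ne_zero.2 hm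
  set y := Real.log (3 * m) with hy
  have hy1 : 1 ≤ y := by
    rw [hy, Real.le_log_iff_exp_le (by linarith)]
    linarith [Real.exp_one_lt_three]
  have hym : Real.log m ≤ y := Real.log_le_log (by linarith) (by linarith)
  rw [← Finset.sum_filter_add_sum_filter_not _ (fun p : ℕ => (p : ℝ) ≤ y)]
  have hsmall : ∑ p ∈ m.primeFactors with ((p : ℕ) : ℝ) ≤ y, Real.log p / p ≤
      Real.log y + A := by
    have hfloor : 1 ≤ ⌊y⌋₊ := Nat.one_le_floor_iff y |>.2 hy1
    have h := (abs_le.1 (hA _ hfloor)).2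
    have hlog : Real.log ⌊y⌋₊ ≤ Real.log y :=
      Real.log_le_log (by exact_mod_cast hfloor) (Nat.floor_le (by linarith))
    refine le_trans (Finset.sum_le_sum_of_subset_of_nonneg (t := ⌊y⌋₊.primesLE) ?_ ?_)
      (by linarith)
    · intro p hp
      rw [Finset.mem_filter] at hp
      exact Nat.mem_primesLE.2 ⟨Nat.le_floor hp.2, Nat.prime_of_mem_primeFactors hp.1⟩
    · exact fun p _ _ => div_nonneg (Real.log_natCast_nonneg p) p.cast_nonneg
  have hlarge : ∑ p ∈ m.primeFactors with ¬ ((p : ℕ) : ℝ) ≤ y, Real.log p / p ≤ 1 := by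
    calc _ ≤ ∑ p ∈ m.primeFactors with ¬ ((p : ℕ) : ℝ) ≤ y, Real.log p / y := by
          refine Finset.sum_le_sum fun p hp => ?_
          rw [Finset.mem_filter, not_le] at hp
          exact div_le_div_of_nonneg_left (Real.log_natCast_nonneg p) (by linarith) hp.2.le
      _ ≤ ∑ p ∈ m.primeFactors, Real.log p / y :=
          Finset.sum_le_sum_of_subset_of_nonneg (Finset.filter_subset _ _)
            fun p _ _ => div_nonneg (Real.log_natCast_nonneg p) (by linarith)
      _ = Real.log (∏ p ∈ m.primeFactors, p : ℕ) / y := by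
          rw [Nat.cast_prod, Real.log_prod, Finset.sum_div]
          exact fun p hp => by exact_mod_cast (Nat.prime_of_mem_primeFactors hp).ne_zero
      _ ≤ 1 := by
          rw [div_le_one (by linarith)]
          refine le_trans (Real.log_le_log ?_ ?_) hym
          · exact_mod_cast Finset.prod_pos fun p hp => (Nat.prime_of_mem_primeFactors hp).pos
          · exact_mod_cast Nat.le_of_dvd (Nat.pos_of_ne_zero hm) (Nat.prod_primeFactors_dvd m)
  linarith

theorem nuH_le_card (H : Finset ℤ) (p : ℕ) : nuH H p ≤ H.card :=
  Finset.card_image_le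

theorem nuH_image_eq_of_not_dvd {k : ℕ} {f : Fin k → ℕ} {p : ℕ}
    (hp : ¬ (p : ℤ) ∣ ∏ i : Fin k, ∏ j ∈ Finset.univ.filter (fun j => i < j),
      ((f i : ℤ) - (f j : ℤ))) :
    nuH (Finset.image (fun i => (f i : ℤ)) Finset.univ) p = k := by
  have hlt : ∀ i j : Fin k, i < j → (f i : ℤ) % p ≠ (f j : ℤ) % p := by
    intro i j hij h
    refine hp (dvd_trans ?_ (Finset.dvd_prod_of_mem _ (Finset.mem_univ i)))
    refine dvd_trans ?_ (Finset.dvd_prod_of_mem _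
      (Finset.mem_filter.2 ⟨Finset.mem_univ j, hij⟩))
    exact Int.ModEq.dvd (Int.ModEq.symm h)
  rw [nuH, Finset.image_image, Finset.card_image_of_injective, Finset.card_univ,
    Fintype.card_fin]
  intro i j h
  by_contra hne
  rcases lt_or_gt_of_ne hne with hij | hij
  · exact hlt i j hij h
  · exact hlt j i hij h.symm

theorem Admissible.nuH_div_le {H : Finset ℤ} (hH : Admissible H) {p : ℕ} (hp : p.Prime) :
    (nuH H p : ℝ) / p ≤ 1 - 1 / ((H.card : ℝ) + 1) := by
  have hp0 : (0 : ℝ) < p := by exact_mod_cast hp.pos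
  have hk : (0 : ℝ) < (H.card : ℝ) + 1 := by positivity
  have h1 : (nuH H p : ℝ) + 1 ≤ p := by exact_mod_cast hH p hp
  have h2 : (nuH H p : ℝ) ≤ H.card := by exact_mod_cast nuH_le_card H p
  have hnu : (0 : ℝ) ≤ nuH H p := Nat.cast_nonneg _
  rw [one_sub_div hk.ne', div_le_div_iff₀ hp0 hk]
  nlinarith

/-- For an admissible set `𝓗` of `k ≥ 2` distinct natural numbers with
`D_𝓗 = ∏_{i<j}(hᵢ - hⱼ)`: (i) `ν_𝓗(p)/p ≤ 1 - 1/(k+1)` for every prime `p`; and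
(ii) there is an absolute `C > 0` such that for `2 ≤ w ≤ z`,
`∑_{w ≤ p < z} ν_𝓗(p) log p / p ≤ k log(z/w) + C k` and
`∑_{w ≤ p < z} ν_𝓗(p) log p / p ≥ k log(z/w) - C k - C k log log(3|D_𝓗|)`. -/
theorem sieve_conditions :
    ∃ C > (0 : ℝ), ∀ k : ℕ, 2 ≤ k → ∀ f : Fin k → ℕ, Function.Injective f →
      Admissible (Finset.image (fun i => (f i : ℤ)) Finset.univ) →
      (∀ p : ℕ, p.Prime →
          (nuH (Finset.image (fun i => (f i : ℤ)) Finset.univ) p : ℝ) / p ≤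
            1 - 1 / ((k : ℝ) + 1)) ∧
      ∀ w z : ℝ, 2 ≤ w → w ≤ z →
        (∑ p ∈ (Finset.Ico ⌈w⌉₊ ⌈z⌉₊).filter Nat.Prime,
            (nuH (Finset.image (fun i => (f i : ℤ)) Finset.univ) p : ℝ) *
              Real.log p / p ≤ (k : ℝ) * Real.log (z / w) + C * k) ∧
        ((k : ℝ) * Real.log (z / w) - C * k -
            C * k * Real.log (Real.log (3 * |((∏ i : Fin k,
              ∏ j ∈ Finset.univ.filter (fun j => i < j),
                ((f i : ℤ) - (f j : ℤ)) : ℤ) : ℝ)|)) ≤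
          ∑ p ∈ (Finset.Ico ⌈w⌉₊ ⌈z⌉₊).filter Nat.Prime,
            (nuH (Finset.image (fun i => (f i : ℤ)) Finset.univ) p : ℝ) *
              Real.log p / p) := by
  obtain ⟨A, hA⟩ := exists_abs_sum_primesBelow_ceil_log_div_sub_log_le
  obtain ⟨B, hB⟩ := exists_sum_primeFactors_log_div_le
  refine ⟨max 1 (2 * A + max B 0), by positivity, fun k _ f hf hadm => ?_⟩
  have hC1 : 1 ≤ max 1 (2 * A + max B 0) := le_max_left _ _
  have hC2 : 2 * A + max B 0 ≤ max 1 (2 * A + max B 0) := le_max_right _ _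
  have hB0 : 0 ≤ max B 0 := le_max_right _ _
  have hB1 : B ≤ max B 0 := le_max_left _ _
  generalize max 1 (2 * A + max B 0) = C at *
  generalize max B 0 = B' at *
  have hcard : (Finset.image (fun i => (f i : ℤ)) Finset.univ).card = k := by
    rw [Finset.card_image_of_injective _ fun i j h => hf (Nat.cast_injective h), Finset.card_univ,
      Fintype.card_fin]
  refine ⟨fun p hp => by simpa only [hcard] using hadm.nuH_div_le hp, fun w z hw hwz => ?_⟩
  have hsum : ∑ p ∈ (Finset.Ico ⌈w⌉₊ ⌈z⌉₊).filter Nat.Prime, Real.log p / p =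
      ∑ p ∈ ⌈z⌉₊.primesBelow, Real.log p / p - ∑ p ∈ ⌈w⌉₊.primesBelow, Real.log p / p := by
    simp only [Nat.primesBelow, Finset.sum_filter]
    exact Finset.sum_Ico_eq_sub _ (Nat.ceil_mono hwz)
  have hz := abs_le.1 (hA z (hw.trans hwz))
  have hw' := abs_le.1 (hA w hw)
  have hlogdiv : Real.log (z / w) = Real.log z - Real.log w :=
    Real.log_div (by linarith) (by linarith)
  have hnonneg : ∀ p : ℕ, 0 ≤ Real.log p / p := fun p =>
    div_nonneg (Real.log_natCast_nonneg p) p.cast_nonneg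
  have hk : (0 : ℝ) ≤ k := k.cast_nonneg
  constructor
  · calc _ ≤ ∑ p ∈ (Finset.Ico ⌈w⌉₊ ⌈z⌉₊).filter Nat.Prime, (k : ℝ) * (Real.log p / p) := by
          refine Finset.sum_le_sum fun p _ => ?_
          rw [mul_div_assoc]
          refine mul_le_mul_of_nonneg_right ?_ (hnonneg p)
          exact_mod_cast (nuH_le_card _ p).trans_eq hcard
      _ ≤ k * (Real.log (z / w) + C) := by
          rw [← Finset.mul_sum]
          refine mul_le_mul_of_nonneg_left ?_ hk
          linarith
      _ = _ := by ring
  · set D : ℤ := ∏ i : Fin k, ∏ j ∈ Finset.univ.filter (fun j => i < j),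
      ((f i : ℤ) - (f j : ℤ)) with hD
    have hD0 : D ≠ 0 := by
      rw [hD, Finset.prod_ne_zero_iff]
      refine fun i _ => Finset.prod_ne_zero_iff.2 fun j hj => sub_ne_zero.2 fun h => ?_
      exact (Finset.mem_filter.1 hj).2.ne (hf (Nat.cast_injective h))
    have hm0 : D.natAbs ≠ 0 := Int.natAbs_ne_zero.2 hD0
    have hDm : |(D : ℝ)| = (D.natAbs : ℝ) := by
      rw [Nat.cast_natAbs, Int.cast_abs]
    rw [hDm]
    have hm := hB D.natAbs hm0
    have hm1 : (1 : ℝ) ≤ D.natAbs := by exact_mod_cast Nat.one_le_iff_ne_zero.2 hm0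
    have hloglog : 0 ≤ Real.log (Real.log (3 * (D.natAbs : ℝ))) := by
      refine Real.log_nonneg ((Real.le_log_iff_exp_le (by linarith)).2 ?_)
      linarith [Real.exp_one_lt_three]
    have hdvd : ∑ p ∈ (Finset.Ico ⌈w⌉₊ ⌈z⌉₊).filter Nat.Prime,
        (if p ∣ D.natAbs then Real.log p / p else 0) ≤
          ∑ p ∈ D.natAbs.primeFactors, Real.log p / p := by
      rw [← Finset.sum_filter]
      refine Finset.sum_le_sum_of_subset_of_nonneg (fun p hp => ?_) fun p _ _ => hnonneg p
      rw [Finset.mem_filter, Finset.mem_filter] at hp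
      exact Nat.mem_primeFactors.2 ⟨hp.1.2, hp.2, hm0⟩
    have hCl := mul_le_mul_of_nonneg_right hC1 hloglog
    calc _ = k * (Real.log (z / w) - C - C * Real.log (Real.log (3 * (D.natAbs : ℝ)))) := by
          ring
      _ ≤ k * ∑ p ∈ (Finset.Ico ⌈w⌉₊ ⌈z⌉₊).filter Nat.Prime,
            (Real.log p / p - if p ∣ D.natAbs then Real.log p / p else 0) := by
          refine mul_le_mul_of_nonneg_left ?_ hk
          rw [Finset.sum_sub_distrib]
          linarith
      _ ≤ _ := by
          rw [Finset.mul_sum]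
          refine Finset.sum_le_sum fun p _ => ?_
          rw [mul_div_assoc]
          split_ifs with h
          · rw [sub_self, mul_zero]
            exact mul_nonneg (Nat.cast_nonneg _) (hnonneg p)
          · rw [sub_zero, nuH_image_eq_of_not_dvd]
            rwa [← hD, Int.natCast_dvd]
end
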